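/- Let f = x_1···x_d in S = K[x_1,...,x_n] and let J ⊂ (f) be a square-free monomial ideal such that the square-free monomials of degree d+1 in (f)\J are exactly fx_{d+1},...,fx_{d+s} (s ≥ 1), and (f)\J contains no square-free monomial of degree d+2. Then (f)/J ≅ K[x_1,...,x_{d+s}]/L as S-modules up to a degree shift, where L is the ideal generated by all square-free degree-2 monomials in x_{d+1},...,x_{d+s}, and depth_S((f)/J) = d+1. -/

import Mathlib

open MvPolynomial

set_option synthInstance.maxHeartbeats 1000000

/-- A squarefree exponent vector. -/
def IsSqfree {n : ℕ} (m : Fin n →₀ ℕ) : Prop := ∀ j, m j ≤ 1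

/-- Total degree of an exponent vector. -/
def mdeg {n : ℕ} (m : Fin n →₀ ℕ) : ℕ := m.sum fun _ e => e

/-- `I` is generated by squarefree monomials of degree `≥ d`. -/
def GenSqfreeGe (K : Type*) [Field K] {n : ℕ} (d : ℕ)
    (I : Ideal (MvPolynomial (Fin n) K)) : Prop :=
  ∃ G : Set (Fin n →₀ ℕ), (∀ m ∈ G, IsSqfree m ∧ d ≤ mdeg m) ∧
    I = Ideal.span ((fun m => monomial m (1 : K)) '' G)

/-- `ρ_t(I \ J)`: the number of squarefree monomials of degree `t` in `I \ J`. -/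
noncomputable def rho (K : Type*) [Field K] {n : ℕ}
    (I J : Ideal (MvPolynomial (Fin n) K)) (t : ℕ) : ℕ :=
  Set.ncard {m : Fin n →₀ ℕ | IsSqfree m ∧ mdeg m = t ∧
    monomial m (1 : K) ∈ I ∧ monomial m (1 : K) ∉ J}

/-- The `S`-module `I/J`. -/
abbrev quotMod {K : Type*} [Field K] {n : ℕ}
    (I J : Ideal (MvPolynomial (Fin n) K)) :=
  I ⧸ (Submodule.comap I.subtype (J : Submodule (MvPolynomial (Fin n) K) (MvPolynomial (Fin n) K)))

/-- Depth of a module over `K[x_1,…,x_n]` w.r.t. the maximal graded ideal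
`(x_1,…,x_n)`: the supremum of lengths of regular sequences on `M` from it. -/
noncomputable def mdepth (K : Type*) [Field K] (n : ℕ)
    (M : Type*) [AddCommGroup M] [Module (MvPolynomial (Fin n) K) M] : ℕ :=
  sSup {k | ∃ rs : List (MvPolynomial (Fin n) K), rs.length = k ∧
    (∀ r ∈ rs, r ∈ Ideal.span (Set.range (X : Fin n → MvPolynomial (Fin n) K))) ∧
    RingTheory.Sequence.IsRegular M rs}

/-- The exponent vector of `f = x_1 ⋯ x_d`. -/
noncomputable def fv (n d : ℕ) : Fin n →₀ ℕ :=
  ∑ j ∈ Finset.univ.filter (fun j : Fin n => (j : ℕ) < d), Finsupp.single j 1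

/-- The squarefree Veronese ideal generated by all squarefree degree-2 monomials
in the variables `x_{d+1}, …, x_{d+s}`. -/
noncomputable def veroneseL (K : Type*) [Field K] (d s : ℕ) :
    Ideal (MvPolynomial (Fin (d + s)) K) :=
  Ideal.span {p | ∃ j k : Fin (d + s), j ≠ k ∧ d ≤ (j : ℕ) ∧ d ≤ (k : ℕ) ∧
    p = X j * X k}

/-- The natural projection `K[x_1,…,x_n] → K[x_1,…,x_{d+s}]/L` killing the
last variables. -/
noncomputable def proj (K : Type*) [Field K] (n d s : ℕ) :
    MvPolynomial (Fin n) K →+* MvPolynomial (Fin (d + s)) K ⧸ veroneseL K d s :=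
  (Ideal.Quotient.mk (veroneseL K d s)).comp
    (MvPolynomial.aeval (fun i : Fin n =>
      if h : (i : ℕ) < d + s then X (⟨i, h⟩ : Fin (d + s)) else 0)).toRingHom

/-- Exponent vectors generating the ideal `(x_j x_k, x_l, x_m)` with `j ≠ k` both `≥ d`,
`l ≥ d + s` and `m < i` (indices counted from `0`). -/
def colonExps (n d s i : ℕ) : Set (Fin n →₀ ℕ) :=
  {m | (∃ j k : Fin n, j ≠ k ∧ d ≤ (j : ℕ) ∧ d ≤ (k : ℕ) ∧
      m = Finsupp.single j 1 + Finsupp.single k 1) ∨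
    ∃ j : Fin n, (d + s ≤ (j : ℕ) ∨ (j : ℕ) < i) ∧ m = Finsupp.single j 1}

/-- The monomial ideal generated by `colonExps n d s i`. -/
noncomputable def colonIdeal (K : Type*) [Field K] (n d s i : ℕ) :
    Ideal (MvPolynomial (Fin n) K) :=
  Ideal.span ((fun m => monomial m (1 : K)) '' colonExps n d s i)

section

variable {K : Type*} [Field K] {n d s : ℕ}

lemma single_mem_colonExps {i : ℕ} {j : Fin n} (hj : d + s ≤ (j : ℕ) ∨ (j : ℕ) < i) :
    Finsupp.single j 1 ∈ colonExps n d s i :=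
  Or.inr ⟨j, hj, rfl⟩

lemma pair_mem_colonExps {i : ℕ} {j k : Fin n} (hjk : j ≠ k) (hj : d ≤ (j : ℕ))
    (hk : d ≤ (k : ℕ)) :
    Finsupp.single j 1 + Finsupp.single k 1 ∈ colonExps n d s i :=
  Or.inl ⟨j, k, hjk, hj, hk, rfl⟩

lemma mem_colonIdeal {i : ℕ} {g : MvPolynomial (Fin n) K} :
    g ∈ colonIdeal K n d s i ↔ ∀ m ∈ g.support, ∃ t ∈ colonExps n d s i, t ≤ m :=
  mem_ideal_span_monomial_image

lemma monomial_mem_colonIdeal {i : ℕ} {m : Fin n →₀ ℕ}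
    (h : ∃ t ∈ colonExps n d s i, t ≤ m) (c : K) : monomial m c ∈ colonIdeal K n d s i := by
  classical
  rw [mem_colonIdeal]
  intro m' hm'
  have := support_monomial_subset hm'
  simp only [Finset.mem_singleton] at this
  rwa [this]

lemma X_mem_colonIdeal {i : ℕ} {j : Fin n} (hj : d + s ≤ (j : ℕ) ∨ (j : ℕ) < i) :
    (X j : MvPolynomial (Fin n) K) ∈ colonIdeal K n d s i :=
  monomial_mem_colonIdeal ⟨_, single_mem_colonExps hj, le_rfl⟩ 1

lemma X_mul_X_mem_colonIdeal {i : ℕ} {j k : Fin n} (hjk : j ≠ k) (hj : d ≤ (j : ℕ))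
    (hk : d ≤ (k : ℕ)) : (X j * X k : MvPolynomial (Fin n) K) ∈ colonIdeal K n d s i := by
  have := monomial_mem_colonIdeal (K := K)
    ⟨_, pair_mem_colonExps (n := n) (s := s) (i := i) hjk hj hk, le_rfl⟩ 1
  simpa [X, monomial_mul] using this

lemma colonIdeal_le {i : ℕ} {I : Ideal (MvPolynomial (Fin n) K)}
    (hpair : ∀ j k : Fin n, j ≠ k → d ≤ (j : ℕ) → d ≤ (k : ℕ) → X j * X k ∈ I)
    (hX : ∀ j : Fin n, (d + s ≤ (j : ℕ) ∨ (j : ℕ) < i) → X j ∈ I) :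
    colonIdeal K n d s i ≤ I := by
  refine Ideal.span_le.2 ?_
  rintro _ ⟨m, ⟨j, k, hjk, hj, hk, rfl⟩ | ⟨j, hj, rfl⟩, rfl⟩
  · simpa [X, monomial_mul] using hpair j k hjk hj hk
  · exact hX j hj

lemma colonIdeal_le_ker_constantCoeff (i : ℕ) :
    colonIdeal K n d s i ≤ RingHom.ker (constantCoeff (R := K) (σ := Fin n)) :=
  colonIdeal_le (fun j k _ _ _ => by simp [RingHom.mem_ker])
    (fun j _ => by simp [RingHom.mem_ker])

/-- Multiplication by a variable `x_i` with `i < d` is injective modulo `colonIdeal K n d s i`. -/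
lemma mem_colonIdeal_of_X_mul_mem {i : Fin n} (hi : (i : ℕ) < d) {g : MvPolynomial (Fin n) K}
    (h : X i * g ∈ colonIdeal K n d s i) : g ∈ colonIdeal K n d s i := by
  rw [mem_colonIdeal] at h ⊢
  intro m hm
  obtain ⟨t, ht, htm⟩ := h (Finsupp.single i 1 + m) (by
    rw [support_X_mul]
    exact Finset.mem_map_of_mem _ hm)
  refine ⟨t, ht, fun j => ?_⟩
  by_cases hji : j = i
  · subst hji
    suffices t j = 0 by omega
    obtain ⟨a, b, -, ha, hb, rfl⟩ | ⟨a, ha, rfl⟩ := ht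
    · simp only [Finsupp.add_apply, Finsupp.single_apply]
      rw [if_neg (by rintro rfl; omega), if_neg (by rintro rfl; omega), add_zero]
    · rw [Finsupp.single_apply, if_neg (by rintro rfl; omega)]
  · simpa [Finsupp.single_apply, Ne.symm hji] using htm j

/-- The sum `x_{d+1} + ⋯ + x_{d+s}`. -/
noncomputable def blockSum (K : Type*) [Field K] (n d s : ℕ) : MvPolynomial (Fin n) K :=
  ∑ j ∈ Finset.univ.filter (fun j : Fin n => d ≤ (j : ℕ) ∧ (j : ℕ) < d + s), X j

lemma exists_eq_single_of_notMem (hs : 1 ≤ s) (hds : d + s ≤ n) {m : Fin n →₀ ℕ}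
    (hm : ¬ ∃ t ∈ colonExps n d s d, t ≤ m) :
    ∃ j : Fin n, d ≤ (j : ℕ) ∧ (j : ℕ) < d + s ∧ ∃ a, m = Finsupp.single j a := by
  have hsupp : ∀ j, m j ≠ 0 → d ≤ (j : ℕ) ∧ (j : ℕ) < d + s := by
    intro j hj
    by_contra hc
    exact hm ⟨_, single_mem_colonExps (j := j) (by omega),
      Finsupp.single_le_iff.2 (by omega)⟩
  by_cases h0 : m = 0
  · exact ⟨⟨d, by omega⟩, le_rfl, by simp; omega, 0, by simp [h0]⟩
  obtain ⟨j, hj⟩ := Finsupp.ne_iff.1 h0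
  simp only [Finsupp.coe_zero, Pi.zero_apply] at hj
  refine ⟨j, (hsupp j hj).1, (hsupp j hj).2, m j, ?_⟩
  ext k
  rw [Finsupp.single_apply]
  split_ifs with hjk
  · rw [hjk]
  · by_contra hk
    refine hm ⟨_, pair_mem_colonExps hjk (hsupp j hj).1 (hsupp k hk).1, fun l => ?_⟩
    simp only [Finsupp.add_apply, Finsupp.single_apply]
    split_ifs with h1 h2 h2
    · exact absurd (h1.trans h2.symm) hjk
    · subst h1; omega
    · subst h2; omega
    · simp

/-- Multiplication by `x_{d+1} + ⋯ + x_{d+s}` is injective modulo `colonIdeal K n d s d`. -/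
lemma mem_colonIdeal_of_blockSum_mul_mem (hs : 1 ≤ s) (hds : d + s ≤ n)
    {g : MvPolynomial (Fin n) K}
    (h : blockSum K n d s * g ∈ colonIdeal K n d s d) : g ∈ colonIdeal K n d s d := by
  classical
  rw [mem_colonIdeal] at h ⊢
  intro m hm
  by_contra hc
  obtain ⟨j, hdj, hj, a, rfl⟩ := exists_eq_single_of_notMem hs hds hc
  have hcoeff : coeff (Finsupp.single j (a + 1)) (blockSum K n d s * g) =
      coeff (Finsupp.single j a) g := by
    rw [blockSum, Finset.sum_mul, coeff_sum, Finset.sum_eq_single j]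
    · rw [coeff_X_mul', if_pos (by simp), ← Finsupp.single_tsub]
      simp
    · intro k _ hk
      rw [coeff_X_mul', if_neg (by simp [Ne.symm hk])]
    · simp [hdj, hj]
  obtain ⟨t, ⟨p, q, hpq, hp, hq, rfl⟩ | ⟨p, hp, rfl⟩, htm⟩ := h (Finsupp.single j (a + 1)) (by
    rw [mem_support_iff, hcoeff]
    exact mem_support_iff.1 hm)
  · have h1 := htm p
    have h2 := htm q
    simp only [Finsupp.add_apply, Finsupp.single_apply] at h1 h2
    have hjp : j = p := by by_contra hne; simp [hne] at h1
    have hjq : j = q := by by_contra hne; simp [hne] at h2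
    exact hpq (hjp.symm.trans hjq)
  · have h1 := htm p
    have hjp : j ≠ p := by rintro rfl; omega
    simp [hjp] at h1

lemma mk_mem_ofList_smul_top {R : Type*} [CommRing R] (I : Ideal R) (rs : List R) (g : R) :
    (Ideal.Quotient.mk I g) ∈ (Ideal.ofList rs • ⊤ : Submodule R (R ⧸ I)) ↔
      g ∈ I ⊔ Ideal.ofList rs := by
  have h : (Ideal.ofList rs • ⊤ : Submodule R (R ⧸ I)) =
      Submodule.map (Submodule.mkQ I) (Ideal.ofList rs) := by
    rw [← Submodule.range_mkQ I, LinearMap.range_eq_map, ← Submodule.map_smul'']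
    simp
  rw [h]
  change Submodule.mkQ I g ∈ _ ↔ _
  rw [← Submodule.mem_comap, Submodule.comap_map_mkQ]

lemma isWeaklyRegular_quotient_iff {R : Type*} [CommRing R] (I : Ideal R) (rs : List R) :
    RingTheory.Sequence.IsWeaklyRegular (R ⧸ I) rs ↔ ∀ (i : ℕ) (hi : i < rs.length) (g : R),
      rs[i] * g ∈ I ⊔ Ideal.ofList (rs.take i) → g ∈ I ⊔ Ideal.ofList (rs.take i) := by
  rw [RingTheory.Sequence.isWeaklyRegular_iff]
  refine forall₂_congr fun i hi => ?_
  rw [isSMulRegular_quotient_iff_mem_of_smul_mem, (Ideal.Quotient.mk_surjective (I := I)).forall]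
  refine forall_congr' fun g => ?_
  rw [← mk_mem_ofList_smul_top, ← mk_mem_ofList_smul_top]
  rfl

/-- The sequence `x_1, …, x_d, x_{d+1} + ⋯ + x_{d+s}`. -/
noncomputable def regSeq (K : Type*) [Field K] (n d s i : ℕ) : MvPolynomial (Fin n) K :=
  if h : i < d ∧ i < n then X ⟨i, h.2⟩ else blockSum K n d s

lemma colonIdeal_sup_ofList {i : ℕ} (hi : i ≤ d) (hdn : d ≤ n) :
    colonIdeal K n d s 0 ⊔ Ideal.ofList ((List.range i).map (regSeq K n d s)) =
      colonIdeal K n d s i := by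
  refine le_antisymm (sup_le ?_ (Ideal.span_le.2 ?_)) ?_
  · exact colonIdeal_le (fun _ _ => X_mul_X_mem_colonIdeal)
      (fun _ h => X_mem_colonIdeal (h.imp_right (by omega)))
  · intro r hr
    obtain ⟨j, hj, rfl⟩ := List.mem_map.1 hr
    rw [List.mem_range] at hj
    rw [regSeq, dif_pos (by omega)]
    exact X_mem_colonIdeal (Or.inr hj)
  · refine colonIdeal_le (fun _ _ h h' h'' => Ideal.mem_sup_left (X_mul_X_mem_colonIdeal h h' h''))
      ?_
    rintro j (h | h)
    · exact Ideal.mem_sup_left (X_mem_colonIdeal (Or.inl h))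
    · refine Ideal.mem_sup_right (Ideal.subset_span (List.mem_map.2 ⟨j, List.mem_range.2 h, ?_⟩))
      rw [regSeq, dif_pos (by omega)]

lemma constantCoeff_regSeq (i : ℕ) : constantCoeff (regSeq K n d s i) = 0 := by
  unfold regSeq blockSum
  split_ifs <;> simp

lemma isRegular_regSeq (hs : 1 ≤ s) (hds : d + s ≤ n) :
    RingTheory.Sequence.IsRegular (MvPolynomial (Fin n) K ⧸ colonIdeal K n d s 0)
      ((List.range (d + 1)).map (regSeq K n d s)) := by
  refine ⟨(isWeaklyRegular_quotient_iff _ _).2 fun i hi g => ?_, fun htop => ?_⟩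
  · simp only [List.length_map, List.length_range] at hi
    rw [← List.map_take, List.take_range, min_eq_left (by omega),
      colonIdeal_sup_ofList (by omega) (by omega)]
    simp only [List.getElem_map, List.getElem_range]
    obtain hid | rfl : i < d ∨ i = d := by omega
    · rw [regSeq, dif_pos (by omega)]
      exact mem_colonIdeal_of_X_mul_mem (i := ⟨i, by omega⟩) hid
    · rw [regSeq, dif_neg (by omega)]
      exact mem_colonIdeal_of_blockSum_mul_mem hs hds
  · have h1 : (1 : MvPolynomial (Fin n) K) ∈ colonIdeal K n d s 0 ⊔
        Ideal.ofList ((List.range (d + 1)).map (regSeq K n d s)) := by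
      rw [← mk_mem_ofList_smul_top, ← htop]
      trivial
    have hle : colonIdeal K n d s 0 ⊔
        Ideal.ofList ((List.range (d + 1)).map (regSeq K n d s)) ≤
          RingHom.ker (constantCoeff (R := K) (σ := Fin n)) := by
      refine sup_le (colonIdeal_le_ker_constantCoeff 0) (Ideal.span_le.2 fun r hr => ?_)
      obtain ⟨j, -, rfl⟩ := List.mem_map.1 hr
      exact constantCoeff_regSeq j
    simpa [RingHom.mem_ker] using hle h1

lemma regSeq_mem_span_X (i : ℕ) :
    regSeq K n d s i ∈ Ideal.span (Set.range (X : Fin n → MvPolynomial (Fin n) K)) := by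
  unfold regSeq blockSum
  split_ifs
  · exact Ideal.subset_span ⟨_, rfl⟩
  · exact Ideal.sum_mem _ fun j _ => Ideal.subset_span ⟨_, rfl⟩

/-- A prime containing `x_j x_k` for all `j ≠ k` in the range `≥ d`, and `x_l` for `l ≥ d + s`,
contains all but one of the variables of index `≥ d`. -/
lemma exists_forall_X_mem {P : Ideal (MvPolynomial (Fin n) K)} [P.IsPrime] (hs : 1 ≤ s)
    (hds : d + s ≤ n) (hP : colonIdeal K n d s 0 ≤ P) :
    ∃ j₀ : Fin n, ∀ j : Fin n, d ≤ (j : ℕ) → j ≠ j₀ → X j ∈ P := by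
  by_cases h : ∃ j₀ : Fin n, d ≤ (j₀ : ℕ) ∧ X j₀ ∉ P
  · obtain ⟨j₀, hj₀, hX⟩ := h
    exact ⟨j₀, fun j hj hne =>
      (Ideal.IsPrime.mem_or_mem ‹_› (hP (X_mul_X_mem_colonIdeal hne hj hj₀))).resolve_right hX⟩
  · push Not at h
    exact ⟨⟨d, by omega⟩, fun j hj _ => h j hj⟩

lemma ringKrullDim_quotient_span_X_le (hdn : d ≤ n) (j₀ : Fin n) :
    ringKrullDim (MvPolynomial (Fin n) K ⧸ Ideal.span
      {p : MvPolynomial (Fin n) K | ∃ j : Fin n, d ≤ (j : ℕ) ∧ j ≠ j₀ ∧ p = X j}) ≤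
      (d + 1 : ℕ) := by
  set T := Ideal.span {p : MvPolynomial (Fin n) K | ∃ j : Fin n, d ≤ (j : ℕ) ∧ j ≠ j₀ ∧ p = X j}
  let φ : MvPolynomial (Option (Fin d)) K →ₐ[K] MvPolynomial (Fin n) K ⧸ T :=
    aeval fun o => Ideal.Quotient.mk T (X (o.elim j₀ (Fin.castLE hdn)))
  have hφ : Function.Surjective φ := by
    have hX : ∀ j : Fin n, Ideal.Quotient.mk T (X j) ∈ φ.range := by
      intro j
      by_cases hj : (j : ℕ) < d
      · exact ⟨X (some ⟨j, hj⟩), by simp [φ]⟩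
      by_cases hj₀ : j = j₀
      · exact ⟨X none, by simp [φ, hj₀]⟩
      · have hjT : X j ∈ T := Ideal.subset_span ⟨j, by omega, hj₀, rfl⟩
        rw [Ideal.Quotient.eq_zero_iff_mem.2 hjT]
        exact zero_mem _
    intro y
    obtain ⟨g, rfl⟩ := Ideal.Quotient.mk_surjective y
    change Ideal.Quotient.mk T g ∈ φ.range
    induction g using MvPolynomial.induction_on with
    | C a => exact φ.range.algebraMap_mem a
    | add p q hp hq => rw [map_add]; exact add_mem hp hq
    | mul_X p j hp => rw [map_mul]; exact mul_mem hp (hX j)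
  refine (ringKrullDim_le_of_surjective φ.toRingHom hφ).trans ?_
  rw [MvPolynomial.ringKrullDim_of_isNoetherianRing, ringKrullDim_eq_zero_of_field]
  simp

lemma ringKrullDim_quotient_colonIdeal_le (hs : 1 ≤ s) (hds : d + s ≤ n) :
    ringKrullDim (MvPolynomial (Fin n) K ⧸ colonIdeal K n d s 0) ≤ (d + 1 : ℕ) := by
  rw [ringKrullDim_quotient]
  refine iSup_le fun p => ?_
  have hprime := p.head.1.2
  obtain ⟨j₀, hj₀⟩ := exists_forall_X_mem hs hds (p.head.2 : colonIdeal K n d s 0 ≤ _)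
  refine le_trans ?_ (ringKrullDim_quotient_span_X_le (K := K) (d := d) (by omega) j₀)
  rw [ringKrullDim_quotient]
  refine Order.le_krullDim_iff.2 ⟨{
    length := p.length
    toFun := fun i => ⟨(p i).1, ?_⟩
    step := fun i => p.step i }, rfl⟩
  refine (PrimeSpectrum.mem_zeroLocus _ _).2 (Ideal.span_le.2 ?_)
  rintro _ ⟨j, hj, hne, rfl⟩
  exact (p.monotone (Fin.zero_le i) : p.head ≤ p i) (hj₀ j hj hne)

end

/-- The length of a regular sequence is bounded by the dimension of the module. -/
lemma length_le_supportDim_of_isRegular {R : Type*} [CommRing R] (rs : List R) :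
    ∀ {M : Type*} [AddCommGroup M] [Module R M] [Module.Finite R M],
      RingTheory.Sequence.IsRegular M rs → (rs.length : WithBot ℕ∞) ≤ Module.supportDim R M := by
  induction rs with
  | nil =>
    intro M _ _ _ h
    have := h.nontrivial
    have h0 := (Module.supportDim_ne_bot_iff_nontrivial R M).2 this
    simpa using WithBot.coe_unbot _ h0 ▸ WithBot.coe_le_coe.2 (zero_le)
  | cons r rs ih =>
    intro M _ _ _ h
    obtain ⟨hr, hrs⟩ := (RingTheory.Sequence.isRegular_cons_iff M r rs).1 h
    refine le_trans ?_ (Module.supportDim_quotSMulTop_succ_le_of_notMem_minimalPrimes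
      fun p hp => hr.notMem_of_mem_minimalPrimes hp)
    push_cast [List.length_cons]
    gcongr
    exact ih hrs

lemma nonempty_quotient_ker_linearEquiv {R A : Type*} [CommRing R] [CommRing A] (φ : R →+* A)
    (hφ : Function.Surjective φ) :
    letI : Module R A := Module.compHom A φ
    Nonempty ((R ⧸ RingHom.ker φ) ≃ₗ[R] A) := by
  let : Module R A := Module.compHom A φ
  refine ⟨{ (RingHom.quotientKerEquivOfSurjective hφ).toAddEquiv with
    map_smul' := fun r x => ?_ }⟩
  obtain ⟨g, rfl⟩ := Ideal.Quotient.mk_surjective x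
  exact map_mul φ r g

section

variable {K : Type*} [Field K] {n d s : ℕ}

lemma proj_X (i : Fin n) :
    proj K n d s (X i) = Ideal.Quotient.mk (veroneseL K d s)
      (if h : (i : ℕ) < d + s then X (⟨i, h⟩ : Fin (d + s)) else 0) := by
  simp [proj]

lemma proj_rename (hds : d + s ≤ n) (p : MvPolynomial (Fin (d + s)) K) :
    proj K n d s (rename (Fin.castLE hds) p) = Ideal.Quotient.mk (veroneseL K d s) p := by
  simp only [proj, RingHom.comp_apply, AlgHom.toRingHom_eq_coe, RingHom.coe_coe, aeval_rename]
  congr 1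
  conv_rhs => rw [← aeval_X_left_apply p]
  congr 2
  ext i
  simp

lemma proj_surjective (hds : d + s ≤ n) : Function.Surjective (proj K n d s) := fun y => by
  obtain ⟨p, rfl⟩ := Ideal.Quotient.mk_surjective y
  exact ⟨_, proj_rename hds p⟩

lemma ker_proj (hds : d + s ≤ n) : RingHom.ker (proj K n d s) = colonIdeal K n d s 0 := by
  refine le_antisymm (fun g hg => ?_) (colonIdeal_le (fun j k hjk hj hk => ?_) fun j hj => ?_)
  · let θ : MvPolynomial (Fin n) K →ₐ[K] MvPolynomial (Fin (d + s)) K :=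
      aeval fun i : Fin n => if h : (i : ℕ) < d + s then X (⟨i, h⟩ : Fin (d + s)) else 0
    have hθ : θ g ∈ veroneseL K d s := Ideal.Quotient.eq_zero_iff_mem.1 hg
    have hL : veroneseL K d s ≤
        (colonIdeal K n d s 0).comap (rename (Fin.castLE hds)) := by
      refine Ideal.span_le.2 ?_
      rintro _ ⟨j, k, hjk, hj, hk, rfl⟩
      rw [SetLike.mem_coe, Ideal.mem_comap, map_mul, rename_X, rename_X]
      exact X_mul_X_mem_colonIdeal (by simpa using hjk) (by simpa using hj) (by simpa using hk)
    have hcomp : (Ideal.Quotient.mkₐ K (colonIdeal K n d s 0)).comp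
        ((rename (Fin.castLE hds)).comp θ) = Ideal.Quotient.mkₐ K (colonIdeal K n d s 0) := by
      ext i
      by_cases hi : (i : ℕ) < d + s
      · simp [θ, hi]
      · have := Ideal.Quotient.eq_zero_iff_mem.2
          (X_mem_colonIdeal (K := K) (d := d) (s := s) (i := 0) (j := i) (Or.inl (by omega)))
        simp [θ, hi, this]
    rw [← Ideal.Quotient.eq_zero_iff_mem, ← Ideal.Quotient.mkₐ_eq_mk K, ← hcomp]
    exact Ideal.Quotient.eq_zero_iff_mem.2 (hL hθ)
  · rw [RingHom.mem_ker, map_mul, proj_X, proj_X, ← map_mul, Ideal.Quotient.eq_zero_iff_mem]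
    split_ifs
    · exact Ideal.subset_span ⟨_, _, by simpa [Fin.ext_iff] using hjk, hj, hk, rfl⟩
    all_goals simp
  · rw [RingHom.mem_ker, proj_X, dif_neg (by omega), map_zero]

lemma fv_apply (j : Fin n) : fv n d j = if (j : ℕ) < d then 1 else 0 := by
  simp [fv, Finsupp.finsetSum_apply, Finsupp.single_apply]

lemma mdeg_eq_sum (m : Fin n →₀ ℕ) : mdeg m = ∑ j, m j :=
  Finsupp.sum_fintype _ _ fun _ => rfl

lemma mdeg_add (a b : Fin n →₀ ℕ) : mdeg (a + b) = mdeg a + mdeg b := by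
  simp [mdeg_eq_sum, Finset.sum_add_distrib]

lemma mdeg_single (j : Fin n) (a : ℕ) : mdeg (Finsupp.single j a) = a := by
  simp [mdeg]

lemma mdeg_fv (hdn : d ≤ n) : mdeg (fv n d) = d := by
  simp [mdeg_eq_sum, fv_apply, Fin.card_filter_val_lt, hdn]

lemma finite_setOf_isSqfree : {m : Fin n →₀ ℕ | IsSqfree m}.Finite :=
  (Set.finite_Iic (Finsupp.equivFunOnFinite.symm fun _ => 1)).subset fun _ hm => hm

variable {J : Ideal (MvPolynomial (Fin n) K)}

lemma monomial_fv_add (m : Fin n →₀ ℕ) :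
    monomial (fv n d + m) (1 : K) = monomial m 1 * monomial (fv n d) 1 := by
  rw [monomial_mul, mul_one, add_comm]

lemma monomial_fv_add_mem_span (m : Fin n →₀ ℕ) :
    monomial (fv n d + m) (1 : K) ∈ Ideal.span {monomial (fv n d) (1 : K)} :=
  Ideal.mem_span_singleton'.2 ⟨_, (monomial_fv_add m).symm⟩

/-- The colon ideal `J : f` is generated by the `x_j x_k` and `x_l` with `j ≠ k` of index `≥ d`
and `l` of index `≥ d + s`. -/
lemma mem_colonIdeal_iff_mul_monomial_fv_mem (hs : 1 ≤ s) (hds : d + s ≤ n)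
    (hJI : J < Ideal.span {monomial (fv n d) (1 : K)})
    (hJ : ∃ G : Set (Fin n →₀ ℕ), (∀ m ∈ G, IsSqfree m) ∧
      J = Ideal.span ((fun m => monomial m (1 : K)) '' G))
    (hdeg1 : {m : Fin n →₀ ℕ | IsSqfree m ∧ mdeg m = d + 1 ∧
        monomial m (1 : K) ∈ Ideal.span {monomial (fv n d) (1 : K)} ∧
        monomial m (1 : K) ∉ J}
      = {m : Fin n →₀ ℕ | ∃ j : Fin n, d ≤ (j : ℕ) ∧ (j : ℕ) < d + s ∧
          m = fv n d + Finsupp.single j 1})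
    (hdeg2 : rho K (Ideal.span {monomial (fv n d) (1 : K)}) J (d + 2) = 0)
    (g : MvPolynomial (Fin n) K) :
    g * monomial (fv n d) 1 ∈ J ↔ g ∈ colonIdeal K n d s 0 := by
  constructor
  · intro hg
    have hle : J ≤ Ideal.span {monomial (fv n d) (1 : K)} * colonIdeal K n d s 0 := by
      obtain ⟨G, hG, hJG⟩ := hJ
      rw [hJG]
      refine Ideal.span_le.2 ?_
      rintro _ ⟨m, hm, rfl⟩
      have hmJ : monomial m (1 : K) ∈ J := hJG ▸ Ideal.subset_span ⟨m, hm, rfl⟩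
      obtain ⟨m', rfl⟩ : ∃ m', m = fv n d + m' := by
        have := Ideal.mem_span_singleton.1 (hJI.le hmJ)
        rw [monomial_dvd_monomial] at this
        exact exists_add_of_le (this.1.resolve_left one_ne_zero)
      refine Ideal.mem_span_singleton_mul.2 ⟨monomial m' 1, monomial_mem_colonIdeal ?_ 1, ?_⟩
      swap
      · rw [monomial_mul, one_mul]
      by_contra hc
      have hsupp : ∀ j, m' j ≠ 0 → d ≤ (j : ℕ) ∧ (j : ℕ) < d + s := by
        intro j hj
        have h1 := hG _ hm j
        rw [Finsupp.add_apply, fv_apply] at h1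
        refine ⟨by by_contra h; rw [if_pos (by omega)] at h1; omega, ?_⟩
        by_contra h
        exact hc ⟨_, single_mem_colonExps (j := j) (Or.inl (by omega)),
          Finsupp.single_le_iff.2 (by omega)⟩
      by_cases h0 : m' = 0
      · rw [h0, add_zero] at hmJ
        exact hJI.not_ge ((Ideal.span_singleton_le_iff_mem _).2 hmJ)
      obtain ⟨j, hdj, hj, a, rfl⟩ := exists_eq_single_of_notMem (d := d) hs hds (m := m') (by
        rintro ⟨t, ht | ⟨j, hj, rfl⟩, htm⟩
        · exact hc ⟨t, Or.inl ht, htm⟩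
        · have := hsupp j (Nat.one_le_iff_ne_zero.1 (Finsupp.single_le_iff.1 htm))
          omega)
      have ha : a = 1 := by
        have h1 := hG _ hm j
        rw [Finsupp.add_apply, Finsupp.single_eq_same] at h1
        have : a ≠ 0 := by rintro rfl; simp at h0
        omega
      subst ha
      exact (hdeg1.ge ⟨j, hdj, hj, rfl⟩ : _ ∧ _).2.2.2 hmJ
    obtain ⟨q, hq, hqg⟩ := Ideal.mem_span_singleton_mul.1 (hle hg)
    rw [mul_comm] at hqg
    have hne : monomial (fv n d) (1 : K) ≠ 0 := by simp
    rwa [← mul_right_cancel₀ hne hqg]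
  · refine fun hg => colonIdeal_le
      (I := Submodule.comap (LinearMap.toSpanSingleton _ _ (monomial (fv n d) 1)) J) ?_ ?_ hg
    · intro j k hjk hj hk
      rw [Submodule.mem_comap, LinearMap.toSpanSingleton_apply, smul_eq_mul]
      have hX : (X j * X k : MvPolynomial (Fin n) K) =
          monomial (Finsupp.single j 1 + Finsupp.single k 1) 1 := by simp [X, monomial_mul]
      rw [hX, ← monomial_fv_add]
      rw [rho, Set.ncard_eq_zero (finite_setOf_isSqfree.subset fun m hm => hm.1)] at hdeg2
      by_contra hc
      refine (hdeg2.le ⟨fun l => ?_, ?_, monomial_fv_add_mem_span _, hc⟩ : False)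
      · simp only [Finsupp.add_apply, fv_apply, Finsupp.single_apply]
        split_ifs <;> omega
      · simp [mdeg_add, mdeg_single, mdeg_fv (by omega : d ≤ n)]
    · intro j hj
      rw [Submodule.mem_comap, LinearMap.toSpanSingleton_apply, smul_eq_mul, X, ← monomial_fv_add]
      by_contra hc
      obtain ⟨k, hk, hk', hkj⟩ := hdeg1.le (show fv n d + Finsupp.single j 1 ∈ _ from
        ⟨fun l => by
          simp only [Finsupp.add_apply, fv_apply, Finsupp.single_apply]
          split_ifs <;> omega,
        by simp [mdeg_add, mdeg_single, mdeg_fv (by omega : d ≤ n)],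
        monomial_fv_add_mem_span _, hc⟩)
      have := Finsupp.single_left_injective one_ne_zero (add_left_cancel hkj)
      subst this
      omega

lemma nonempty_quotient_linearEquiv_quotMod {Q : Ideal (MvPolynomial (Fin n) K)}
    {f : MvPolynomial (Fin n) K}
    (h : ∀ g, g * f ∈ J ↔ g ∈ Q) :
    Nonempty ((MvPolynomial (Fin n) K ⧸ Q) ≃ₗ[MvPolynomial (Fin n) K]
      quotMod (Ideal.span {f}) J) := by
  let φ : MvPolynomial (Fin n) K →ₗ[MvPolynomial (Fin n) K] quotMod (Ideal.span {f}) J :=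
    (Submodule.mkQ _).comp
      (LinearMap.toSpanSingleton _ (Ideal.span {f}) ⟨f, Ideal.mem_span_singleton_self f⟩)
  have hφ : Function.Surjective φ := by
    refine (Submodule.mkQ_surjective _).comp ?_
    rintro ⟨x, hx⟩
    obtain ⟨g, rfl⟩ := Ideal.mem_span_singleton'.1 hx
    exact ⟨g, rfl⟩
  have hker : LinearMap.ker φ = Q := by
    ext g
    rw [← h, LinearMap.mem_ker]
    exact Submodule.Quotient.mk_eq_zero _
  exact ⟨(Submodule.quotEquivOfEq _ _ hker.symm).trans (φ.quotKerEquivOfSurjective hφ)⟩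

lemma mdepth_congr {M N : Type*} [AddCommGroup M] [Module (MvPolynomial (Fin n) K) M]
    [AddCommGroup N] [Module (MvPolynomial (Fin n) K) N]
    (e : M ≃ₗ[MvPolynomial (Fin n) K] N) : mdepth K n M = mdepth K n N := by
  simp only [mdepth, e.isRegular_congr]

lemma mdepth_quotient_colonIdeal (hs : 1 ≤ s) (hds : d + s ≤ n) :
    mdepth K n (MvPolynomial (Fin n) K ⧸ colonIdeal K n d s 0) = d + 1 := by
  refine IsGreatest.csSup_eq ⟨⟨(List.range (d + 1)).map (regSeq K n d s), by simp, ?_,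
    isRegular_regSeq hs hds⟩, ?_⟩
  · intro r hr
    obtain ⟨i, -, rfl⟩ := List.mem_map.1 hr
    exact regSeq_mem_span_X i
  · rintro k ⟨rs, rfl, -, hrs⟩
    have h := length_le_supportDim_of_isRegular rs hrs
    rw [Module.supportDim_quotient_eq_ringKrullDim] at h
    exact_mod_cast h.trans (ringKrullDim_quotient_colonIdeal_le hs hds)

end

theorem principal_no_deg_d2 {K : Type*} [Field K] {n d s : ℕ}
    (hd : 1 ≤ d) (hs : 1 ≤ s) (hds : d + s ≤ n)
    (J : Ideal (MvPolynomial (Fin n) K))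
    (hJI : J < Ideal.span {monomial (fv n d) (1 : K)})
    (hJ : ∃ G : Set (Fin n →₀ ℕ), (∀ m ∈ G, IsSqfree m) ∧
      J = Ideal.span ((fun m => monomial m (1 : K)) '' G))
    (hdeg1 : {m : Fin n →₀ ℕ | IsSqfree m ∧ mdeg m = d + 1 ∧
        monomial m (1 : K) ∈ Ideal.span {monomial (fv n d) (1 : K)} ∧
        monomial m (1 : K) ∉ J}
      = {m : Fin n →₀ ℕ | ∃ j : Fin n, d ≤ (j : ℕ) ∧ (j : ℕ) < d + s ∧
          m = fv n d + Finsupp.single j 1})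
    (hdeg2 : rho K (Ideal.span {monomial (fv n d) (1 : K)}) J (d + 2) = 0) :
    (letI : Module (MvPolynomial (Fin n) K)
        (MvPolynomial (Fin (d + s)) K ⧸ veroneseL K d s) :=
      Module.compHom _ (proj K n d s)
     Nonempty ((quotMod (Ideal.span {monomial (fv n d) (1 : K)}) J)
        ≃ₗ[MvPolynomial (Fin n) K]
          (MvPolynomial (Fin (d + s)) K ⧸ veroneseL K d s))) ∧
    mdepth K n (quotMod (Ideal.span {monomial (fv n d) (1 : K)}) J) = d + 1 := by
  have hcolon := mem_colonIdeal_iff_mul_monomial_fv_mem hs hds hJI hJ hdeg1 hdeg2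
  obtain ⟨e⟩ := nonempty_quotient_linearEquiv_quotMod hcolon
  refine ⟨?_, (mdepth_congr e).symm.trans (mdepth_quotient_colonIdeal hs hds)⟩
  obtain ⟨e'⟩ := nonempty_quotient_ker_linearEquiv (proj K n d s) (proj_surjective hds)
  exact ⟨e.symm.trans ((Submodule.quotEquivOfEq _ _ (ker_proj hds).symm).trans e')⟩
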